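/- There do not exist disjoint regular languages L₀, L₁ over the alphabet {0,1} such that L₀ ∪ L₁ has the prefix property and, for every p ∈ (0,1), P_p(L₀ ∪ L₁) = 1 and P_p(L₁) = √p. (The function f(p) = √p cannot be simulated by a finite automaton.) -/

import Mathlib

/-- Probability of a word `w` under i.i.d. `p`-coin tosses. -/
noncomputable def wordProb (p : ℝ) (w : List Bool) : ℝ :=
  p ^ (w.count true) * (1 - p) ^ (w.count false)

/-- Probability of a language under i.i.d. `p`-coin tosses. -/
noncomputable def langProb (p : ℝ) (L : Set (List Bool)) : ℝ :=
  ∑' w : L, wordProb p (w : List Bool)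

/-- A language has the prefix property if no word of it is a proper prefix
of another word of it. -/
def PrefixFree (L : Set (List Bool)) : Prop :=
  ∀ u ∈ L, ∀ v ∈ L, u ≠ v → ¬ u <+: v

theorem wordProb_cons (p : ℝ) (b : Bool) (w : List Bool) :
    wordProb p (b :: w) = (if b then p else 1 - p) * wordProb p w := by
  cases b <;> simp [wordProb, pow_succ] <;> ring

theorem summable_wordProb_cons {p : ℝ} {A : Set (List Bool)}
    (hA : Summable fun w : A => wordProb p w) (b : Bool) :
    Summable fun w : {y | b :: y ∈ A} => wordProb p (b :: (w : List Bool)) := by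
  refine hA.comp_injective (i := fun w : {y | b :: y ∈ A} => (⟨b :: w.1, w.2⟩ : A)) ?_
  rintro ⟨u, hu⟩ ⟨v, hv⟩ h
  simpa using h

theorem summable_wordProb_quotient {p : ℝ} (hp : p ∈ Set.Ioo (0 : ℝ) 1) {A : Set (List Bool)}
    (hA : Summable fun w : A => wordProb p w) (u : List Bool) :
    Summable fun w : {y | u ++ y ∈ A} => wordProb p w := by
  induction u generalizing A with
  | nil => exact hA
  | cons b u ih =>
    refine ih (A := {y | b :: y ∈ A}) ?_
    have h := summable_wordProb_cons hA b
    simp only [wordProb_cons] at h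
    refine (summable_mul_left_iff ?_).1 h
    have := hp.1
    have := hp.2
    split_ifs <;> linarith

/-- First-letter decomposition of the probability of a language without the empty word. -/
theorem langProb_eq_of_nil_notMem {p : ℝ} {A : Set (List Bool)}
    (hA : Summable fun w : A => wordProb p w) (hnil : [] ∉ A) :
    langProb p A =
      p * langProb p {y | true :: y ∈ A} + (1 - p) * langProb p {y | false :: y ∈ A} := by
  have hinj (b : Bool) (s : Set (List Bool)) : Set.InjOn (List.cons b) s :=
    fun u _ v _ h => by simpa using h
  have hunion : A = List.cons true '' {y | true :: y ∈ A} ∪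
      List.cons false '' {y | false :: y ∈ A} := by
    ext w
    rcases w with _ | ⟨_ | _, w⟩ <;> simp [hnil]
  have hdisj : Disjoint (List.cons true '' {y | true :: y ∈ A})
      (List.cons false '' {y | false :: y ∈ A}) := by
    rw [Set.disjoint_left]
    rintro _ ⟨u, -, rfl⟩ ⟨v, -, h⟩
    simp at h
  have hsub (b : Bool) : Summable
      (wordProb p ∘ ((↑) : (List.cons b '' {y | b :: y ∈ A} : Set _) → List Bool)) := by
    refine hA.comp_injective (i := Set.inclusion ?_) (Set.inclusion_injective _)
    rintro _ ⟨u, hu, rfl⟩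
    exact hu
  have hpart (b : Bool) : ∑' w : (List.cons b '' {y | b :: y ∈ A} : Set _), wordProb p w =
      (if b then p else 1 - p) * langProb p {y | b :: y ∈ A} := by
    rw [tsum_image (wordProb p) (hinj b _)]
    simp only [wordProb_cons, langProb, tsum_mul_left]
  have h := (hsub true).tsum_union_disjoint hdisj (hsub false)
  rw [← hunion, hpart, hpart] at h
  simpa [langProb] using h

theorem langProb_empty (p : ℝ) : langProb p ∅ = 0 := by simp [langProb]

theorem langProb_singleton_nil (p : ℝ) : langProb p {[]} = 1 := by
  rw [langProb, tsum_singleton [] (wordProb p)]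
  simp [wordProb]

/-- A prefix-free regular language has rational probability under fair coin tosses. -/
theorem langProb_half_mem_range_ratCast {L : Set (List Bool)}
    (hreg : Language.IsRegular (L : Language Bool)) (hpre : PrefixFree L)
    (hsum : Summable fun w : L => wordProb (1 / 2) w) :
    ∃ q : ℚ, (q : ℝ) = langProb (1 / 2) L := by
  by_contra hne
  have hmem : langProb (1 / 2) L ∉ Submodule.span ℚ {(1 : ℝ)} := by
    rw [Submodule.mem_span_singleton]
    rintro ⟨q, hq⟩
    exact hne ⟨q, by rw [← hq, Rat.smul_one_eq_cast]⟩
  obtain ⟨φ, hφ, hker⟩ := Submodule.exists_dual_map_eq_bot_of_notMem hmem inferInstance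
  have hφ1 : φ 1 = 0 := by
    have : φ 1 ∈ (Submodule.span ℚ {(1 : ℝ)}).map φ :=
      Submodule.mem_map_of_mem (Submodule.mem_span_singleton_self _)
    rwa [hker, Submodule.mem_bot] at this
  let quot (w : List Bool) : Set (List Bool) := {y | w ++ y ∈ L}
  let z (w : List Bool) : ℚ := φ (langProb (1 / 2) (quot w))
  have hfin : (Set.range fun w => |z w|).Finite := by
    have h : (Set.range quot).Finite := hreg.finite_range_leftQuotient
    have := h.image fun A => |φ (langProb (1 / 2) A)|
    rwa [← Set.range_comp] at this
  obtain ⟨_, ⟨w₀, rfl⟩, hmax⟩ := hfin.exists_maximal (Set.range_nonempty _)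
  have hle (w : List Bool) : |z w| ≤ |z w₀| := by
    by_contra! h
    exact (hmax ⟨w, rfl⟩ h.le).not_gt h
  have hpos : 0 < |z w₀| := (abs_pos.2 hφ).trans_le (hle [])
  have havg (w : List Bool) (hw : w ∉ L) : z w = (z (w ++ [true]) + z (w ++ [false])) / 2 := by
    have h := langProb_eq_of_nil_notMem
      (summable_wordProb_quotient (by norm_num) hsum w) (by simpa using hw)
    have hq (b : Bool) : {y | b :: y ∈ {y | w ++ y ∈ L}} = quot (w ++ [b]) := by
      ext y
      simp [quot]
    rw [hq, hq] at h
    have h' : langProb (1 / 2) (quot w) = (1 / 2 : ℚ) •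
        (langProb (1 / 2) (quot (w ++ [true])) + langProb (1 / 2) (quot (w ++ [false]))) := by
      rw [Rat.smul_def]
      push_cast
      linarith
    simp only [z]
    rw [h', map_smul, map_add, smul_eq_mul]
    ring
  have hterm (w : List Bool) (hw : w ∈ L) : z w = 0 := by
    have : quot w = {[]} := by
      ext y
      refine ⟨fun hy => ?_, fun hy => ?_⟩
      · by_contra hne
        exact hpre w hw (w ++ y) hy (by simpa using hne) (List.prefix_append _ _)
      · rw [Set.mem_singleton_iff.1 hy]
        simpa [quot] using hw
    simp only [z]
    rw [this, langProb_singleton_nil, hφ1]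
  have hprop (y : List Bool) : ∀ w, |z w| = |z w₀| → w ++ y ∉ L := by
    induction y with
    | nil =>
      intro w hw hwL
      rw [hterm w (by simpa using hwL), abs_zero] at hw
      exact hpos.ne hw
    | cons b y ih =>
      intro w hw hwL
      have hnw : w ∉ L := fun h => by
        rw [hterm w h, abs_zero] at hw
        exact hpos.ne hw
      refine ih (w ++ [b]) ?_ (by simpa using hwL)
      have h := havg w hnw
      have ht := hle (w ++ [true])
      have hf := hle (w ++ [false])
      have h2 : |z w| * 2 ≤ |z (w ++ [true])| + |z (w ++ [false])| := by
        have h3 : |z w| * 2 = |z (w ++ [true]) + z (w ++ [false])| := by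
          rw [h, abs_div, abs_two, div_mul_cancel₀ _ two_ne_zero]
        exact h3.trans_le (abs_add_le _ _)
      cases b <;> linarith
  have hempty : quot w₀ = ∅ := Set.eq_empty_of_forall_notMem fun y => hprop y w₀ rfl
  have : z w₀ = 0 := by
    simp only [z]
    rw [hempty, langProb_empty, map_zero]
  exact hpos.ne' (by rw [this, abs_zero])

theorem irrational_sqrt_half : Irrational √(1 / 2 : ℝ) := by
  rw [one_div, Real.sqrt_inv]
  exact irrational_sqrt_two.inv

theorem stmt_16 :
    ¬ ∃ L₀ L₁ : Set (List Bool),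
      Language.IsRegular (L₀ : Language Bool) ∧
      Language.IsRegular (L₁ : Language Bool) ∧
      Disjoint L₀ L₁ ∧
      PrefixFree (L₀ ∪ L₁) ∧
      ∀ p ∈ Set.Ioo (0:ℝ) 1,
        langProb p (L₀ ∪ L₁) = 1 ∧ langProb p L₁ = Real.sqrt p := by
  rintro ⟨L₀, L₁, -, hreg, -, hpre, hprob⟩
  have hval := (hprob (1 / 2) (by norm_num)).2
  have hsum : Summable fun w : L₁ => wordProb (1 / 2) w := by
    by_contra h
    rw [langProb, tsum_eq_zero_of_not_summable h] at hval
    exact irrational_sqrt_half.ne_zero hval.symm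
  obtain ⟨q, hq⟩ := langProb_half_mem_range_ratCast hreg
    (fun u hu v hv => hpre u (.inr hu) v (.inr hv)) hsum
  exact irrational_sqrt_half ⟨q, hq.trans hval⟩
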